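/- On a 3-Sasakian manifold (S,g), for every projectable cross section X of E and all α, β ∈ {1,2,3} one has (D̊_{ξ^α} Φ^β)X = 2(1 − δ_{αβ}) Φ^γ X, where for α ≠ β, (α,β,γ) is a cyclic permutation of (1,2,3); consequently the rank-3 bundle Q spanned by (I₁ = −Φ¹|_E, I₂ = −Φ²|_E, I₃ = −Φ³|_E) is a projectable transversal almost quaternionic structure of the foliation V. -/

import Mathlib

/-- Algebraic (Lie–Rinehart style) model of a Riemannian manifold `(S, g)`:
`A` plays the role of `C^∞(S)`, `V` of the vector fields `Γ(TS)`, `g` of the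
metric and `nabla` of its Levi-Civita connection. -/
structure RiemannianModule (A V : Type) [CommRing A] [Algebra ℝ A]
    [AddCommGroup V] [Module ℝ V] [LieRing V] [LieAlgebra ℝ V]
    [Module A V] [IsScalarTower ℝ A V] where
  act : V → Derivation ℝ A A
  leibniz : ∀ (x y : V) (f : A), ⁅x, f • y⁆ = f • ⁅x, y⁆ + act x f • y
  g : V →ₗ[A] V →ₗ[A] A
  g_symm : ∀ x y, g x y = g y x
  nabla : V → V → V
  nabla_add₁ : ∀ x y z, nabla (x + y) z = nabla x z + nabla y z
  nabla_smul₁ : ∀ (f : A) (x z : V), nabla (f • x) z = f • nabla x z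
  nabla_add₂ : ∀ x y z, nabla x (y + z) = nabla x y + nabla x z
  nabla_leib₂ : ∀ (x : V) (f : A) (y : V), nabla x (f • y) = f • nabla x y + act x f • y
  torsionless : ∀ x y, nabla x y - nabla y x = ⁅x, y⁆
  metric : ∀ x y z, act x (g y z) = g (nabla x y) z + g y (nabla x z)

namespace RiemannianModule

variable {A V : Type} [CommRing A] [Algebra ℝ A]
    [AddCommGroup V] [Module ℝ V] [LieRing V] [LieAlgebra ℝ V]
    [Module A V] [IsScalarTower ℝ A V]

/-- `Φ^α = ∇ ξ^α ∈ End(TS)`, i.e. `Φ^α X = ∇_X ξ^α`. -/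
def phiMap (R : RiemannianModule A V) (xi : Fin 3 → V) (i : Fin 3) : V →ₗ[A] V where
  toFun x := R.nabla x (xi i)
  map_add' x y := R.nabla_add₁ x y (xi i)
  map_smul' f x := R.nabla_smul₁ f x (xi i)

variable (A) in
/-- The tangent distribution `TV` of the 3-dimensional foliation `V` spanned
by `ξ¹, ξ², ξ³`. -/
def LofXi (xi : Fin 3 → V) : Submodule A V := Submodule.span A {xi 0, xi 1, xi 2}

/-- The distribution `E` orthogonal to the foliation, `η¹ = η² = η³ = 0`,
where `η^α = ♭_g ξ^α`. -/
def EofXi (R : RiemannianModule A V) (xi : Fin 3 → V) : Submodule A V :=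
  ⨅ i : Fin 3, LinearMap.ker (R.g (xi i))

/-- `(a, b, c)` is a cyclic permutation of `(1, 2, 3)`. -/
def Cyc (a b c : Fin 3) : Prop :=
  (a, b, c) = (0, 1, 2) ∨ (a, b, c) = (1, 2, 0) ∨ (a, b, c) = (2, 0, 1)

end RiemannianModule

open RiemannianModule

namespace RiemannianModule

variable {A V : Type} [CommRing A] [Algebra ℝ A]
    [AddCommGroup V] [Module ℝ V] [LieRing V] [LieAlgebra ℝ V]
    [Module A V] [IsScalarTower ℝ A V]

/-- The bracket is antisymmetric for the additive structure underlying the `A`-module `V`. -/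
theorem lie_eq_neg_lie (R : RiemannianModule A V) (x y : V) : ⁅x, y⁆ = -⁅y, x⁆ := by
  rw [← R.torsionless, ← R.torsionless, neg_sub]

/-- The bracket with a fixed field on the left, as an endomorphism of the additive group
underlying the `A`-module `V`. -/
def adHom (R : RiemannianModule A V) (x : V) : V →+ V :=
  AddMonoidHom.mk' (fun y => ⁅x, y⁆) fun y z => by
    simp only [← R.torsionless, R.nabla_add₁, R.nabla_add₂]
    abel

theorem bracket_add (R : RiemannianModule A V) (x y z : V) : ⁅x, y + z⁆ = ⁅x, y⁆ + ⁅x, z⁆ :=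
  (R.adHom x).map_add y z

theorem bracket_zero (R : RiemannianModule A V) (x : V) : ⁅x, (0 : V)⁆ = 0 :=
  (R.adHom x).map_zero

theorem bracket_neg (R : RiemannianModule A V) (x y : V) : ⁅x, -y⁆ = -⁅x, y⁆ :=
  (R.adHom x).map_neg y

theorem add_bracket (R : RiemannianModule A V) (x y z : V) : ⁅x + y, z⁆ = ⁅x, z⁆ + ⁅y, z⁆ := by
  rw [R.lie_eq_neg_lie, R.bracket_add, R.lie_eq_neg_lie x z, R.lie_eq_neg_lie y z, neg_add]

theorem zero_bracket (R : RiemannianModule A V) (x : V) : ⁅(0 : V), x⁆ = 0 := by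
  rw [R.lie_eq_neg_lie, R.bracket_zero, neg_zero]

/-- The Leibniz rule for the bracket in its first argument. -/
theorem smul_bracket_leibniz (R : RiemannianModule A V) (f : A) (x y : V) :
    ⁅f • x, y⁆ = f • ⁅x, y⁆ - R.act y f • x := by
  rw [R.lie_eq_neg_lie, R.leibniz, R.lie_eq_neg_lie x y, smul_neg]
  abel

/-- The Lie derivative of `Φ^β` along `ξ^α` on a field orthogonal to `ξ^α` and `ξ^β`. -/
theorem lie_phiMap_sub_phiMap_lie (R : RiemannianModule A V) (xi : Fin 3 → V)
    (hsas : ∀ i (y z : V),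
      R.nabla y (phiMap R xi i z) - phiMap R xi i (R.nabla y z) =
        R.g (xi i) z • y - R.g y z • xi i)
    (a b : Fin 3) {x : V} (ha : R.g (xi a) x = 0) (hb : R.g (xi b) x = 0) :
    ⁅xi a, phiMap R xi b x⁆ - phiMap R xi b ⁅xi a, x⁆ =
      phiMap R xi b (phiMap R xi a x) - phiMap R xi a (phiMap R xi b x) := by
  have h := hsas b (xi a) x
  rw [ha, hb, zero_smul, zero_smul, sub_zero, sub_eq_zero] at h
  rw [← R.torsionless, ← R.torsionless, h, map_sub]
  change _ - phiMap R xi a (phiMap R xi b x) - (_ - phiMap R xi b (phiMap R xi a x)) = _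
  abel

/-- The reversed products in an almost hypercomplex structure given by `-Φ`. -/
theorem comp_of_cyc {M : Type} [AddCommGroup M] [Module A M] {Phi : Fin 3 → (M →ₗ[A] M)}
    (hac : ∀ i, (-Phi i) ∘ₗ (-Phi i) = -LinearMap.id)
    (hquat : ∀ a b c, Cyc a b c → (-Phi a) ∘ₗ (-Phi b) = -Phi c)
    {a b c : Fin 3} (h : Cyc a b c) (x : M) :
    Phi a (Phi b x) = -Phi c x ∧ Phi b (Phi a x) = Phi c x := by
  have sq (i : Fin 3) (x : M) : Phi i (Phi i x) = -x := by
    simpa using LinearMap.congr_fun (hac i) x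
  have mul (x : M) : Phi a (Phi b x) = -Phi c x := by
    simpa using LinearMap.congr_fun (hquat a b c h) x
  refine ⟨mul x, ?_⟩
  have key := mul (Phi b (Phi a x))
  rw [sq b, map_neg, sq a, neg_neg] at key
  have key' := congrArg (Phi c) key
  rw [map_neg, sq c, neg_neg] at key'
  exact key'.symm

end RiemannianModule

/-- **Statement 10.**  On a 3-Sasakian manifold `(S, g)` with characteristic
Killing fields `ξ¹, ξ², ξ³` and `Φ^α = ∇ ξ^α`, for every projectable cross
section `X` of `E = T^⊥V` and all `α, β` one has
`(D̊_{ξ^α} Φ^β) X = 2 (1 − δ_{αβ}) Φ^γ X`, where for `α ≠ β` the triple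
`(α, β, γ)` is a cyclic permutation of `(1, 2, 3)`; consequently the rank-3
bundle `Q` spanned by `I_α = −Φ^α|_E` is a projectable transversal almost
quaternionic structure of the foliation `V` spanned by `ξ¹, ξ², ξ³`. -/
theorem threeSasakian_transversal_quaternionic_projectable
    {A V : Type} [CommRing A] [Algebra ℝ A]
    [AddCommGroup V] [Module ℝ V] [LieRing V] [LieAlgebra ℝ V]
    [Module A V] [IsScalarTower ℝ A V]
    (R : RiemannianModule A V) (xi : Fin 3 → V)
    -- `ξ¹, ξ², ξ³` are orthonormal:
    (horth : ∀ i j, R.g (xi i) (xi j) = if i = j then (1 : A) else 0)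
    -- they are Killing vector fields:
    (hkill : ∀ i (x y : V), R.g (R.nabla x (xi i)) y + R.g x (R.nabla y (xi i)) = 0)
    -- the 3-Sasakian bracket relations `[ξ^α, ξ^β] = 2 ξ^γ`:
    (hbrack : ∀ a b c, Cyc a b c → ⁅xi a, xi b⁆ = (2 : A) • xi c)
    -- the defining equation (2.6): `(∇_Y Φ^α) Z = η^α(Z) Y − g(Y, Z) ξ^α`:
    (hsas : ∀ i (y z : V),
      R.nabla y (phiMap R xi i z) - phiMap R xi i (R.nabla y z) =
        R.g (xi i) z • y - R.g y z • xi i)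
    -- `(Φ^α)² = −Id + η^α ⊗ ξ^α`:
    (hsq : ∀ i (x : V), phiMap R xi i (phiMap R xi i x) = -x + R.g (xi i) x • xi i)
    -- `TV` and `E` are `Φ^α`-invariant:
    (hLinv : ∀ i, ∀ x ∈ LofXi A xi, phiMap R xi i x ∈ LofXi A xi)
    (hEinv : ∀ i, ∀ x ∈ EofXi R xi, phiMap R xi i x ∈ EofXi R xi)
    -- `TS = TV ⊕ E`:
    (hcompl : IsCompl (LofXi A xi) (EofXi R xi))
    -- the restrictions `Φ^α|_E`:
    (Phi : Fin 3 → (EofXi R xi →ₗ[A] EofXi R xi))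
    (hPhi : ∀ i (X : EofXi R xi), (Phi i X : V) = phiMap R xi i (X : V))
    -- `(I₁, I₂, I₃) = (−Φ¹|_E, −Φ²|_E, −Φ³|_E)` is almost hypercomplex on `E`:
    (hac : ∀ i, (-Phi i) ∘ₗ (-Phi i) = -LinearMap.id)
    (hquat : ∀ a b c, Cyc a b c → (-Phi a) ∘ₗ (-Phi b) = -Phi c)
    -- the projection `π : TS → E` associated with `TS = TV ⊕ E`:
    (pr : V →ₗ[A] EofXi R xi)
    (hpr : pr = (EofXi R xi).linearProjOfIsCompl (LofXi A xi) hcompl.symm) :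
    -- `(D̊_{ξ^α} Φ^β) X = 2 (1 − δ_{αβ}) Φ^γ X` on projectable sections `X`:
    ((∀ a b c, Cyc a b c → ∀ X : EofXi R xi,
        (∀ Y ∈ LofXi A xi, ⁅Y, (X : V)⁆ ∈ LofXi A xi) →
        pr ⁅xi a, (Phi b X : V)⁆ - Phi b (pr ⁅xi a, (X : V)⁆) = (2 : A) • Phi c X) ∧
      (∀ a, ∀ X : EofXi R xi,
        (∀ Y ∈ LofXi A xi, ⁅Y, (X : V)⁆ ∈ LofXi A xi) →
        pr ⁅xi a, (Phi a X : V)⁆ - Phi a (pr ⁅xi a, (X : V)⁆) = 0)) ∧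
    -- consequently `Q = span(I₁, I₂, I₃)` is preserved by the canonical
    -- partial Bott connection `D̊`, i.e. it is a projectable transversal
    -- almost quaternionic structure of the foliation `V`:
    (∀ Y ∈ LofXi A xi, ∀ S ∈ Submodule.span A {-Phi 0, -Phi 1, -Phi 2},
      ∃ S' ∈ Submodule.span A ({-Phi 0, -Phi 1, -Phi 2} :
          Set (EofXi R xi →ₗ[A] EofXi R xi)),
        ∀ s : EofXi R xi, pr ⁅Y, (S s : V)⁆ - S (pr ⁅Y, (s : V)⁆) = S' s) := by
  have hprL : ∀ y ∈ LofXi A xi, pr y = 0 := fun y hy => by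
    rw [hpr]; exact (Submodule.linearProjOfIsCompl_apply_eq_zero_iff hcompl.symm).2 hy
  have hprE : ∀ y : EofXi R xi, pr (y : V) = y := fun y => by
    rw [hpr]; exact Submodule.linearProjOfIsCompl_apply_left hcompl.symm y
  have hcomm : ∀ i z, pr (phiMap R xi i z) = Phi i (pr z) := fun i z => by
    have hz : z ∈ LofXi A xi ⊔ EofXi R xi := hcompl.sup_eq_top ▸ Submodule.mem_top
    obtain ⟨u, hu, v, hv, rfl⟩ := Submodule.mem_sup.1 hz
    have hv' := hprE (Phi i ⟨v, hv⟩)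
    rw [hPhi] at hv'
    rw [map_add, map_add, map_add, hprL u hu, hprL _ (hLinv i u hu), hv', hprE ⟨v, hv⟩,
      zero_add, zero_add]
  have hE : ∀ i (s : EofXi R xi), R.g (xi i) (s : V) = 0 := fun i s =>
    (Submodule.mem_iInf _).1 s.2 i
  have hD : ∀ a b (s : EofXi R xi),
      pr ⁅xi a, (Phi b s : V)⁆ - Phi b (pr ⁅xi a, (s : V)⁆) =
        Phi b (Phi a s) - Phi a (Phi b s) := fun a b s => by
    rw [hPhi, ← hcomm, ← map_sub,
      lie_phiMap_sub_phiMap_lie R xi hsas a b (hE a s) (hE b s),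
      ← hPhi, ← hPhi, ← hPhi, ← hPhi, map_sub, hprE, hprE]
  have hcyc : ∀ a b c, Cyc a b c → ∀ s : EofXi R xi,
      Phi b (Phi a s) - Phi a (Phi b s) = (2 : A) • Phi c s := fun a b c h s => by
    obtain ⟨h₁, h₂⟩ := comp_of_cyc hac hquat h s
    rw [h₁, h₂]
    module
  refine ⟨⟨fun a b c h X _ => by rw [hD, hcyc a b c h], fun a X _ => by rw [hD, sub_self]⟩, ?_⟩
  intro Y hY S hS
  set Q := Submodule.span A ({-Phi 0, -Phi 1, -Phi 2} : Set (EofXi R xi →ₗ[A] EofXi R xi))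
  have hPhiQ : ∀ i, Phi i ∈ Q := fun i => by
    rw [← Q.neg_mem_iff]
    apply Submodule.subset_span
    fin_cases i <;> simp
  have hgen : ∀ b, ∃ S' ∈ Q, ∀ s : EofXi R xi,
      pr ⁅Y, (Phi b s : V)⁆ - Phi b (pr ⁅Y, (s : V)⁆) = S' s := fun b => by
    have hxi : ∀ a, ∃ S' ∈ Q, ∀ s : EofXi R xi,
        pr ⁅xi a, (Phi b s : V)⁆ - Phi b (pr ⁅xi a, (s : V)⁆) = S' s := fun a => by
      have hcases : a = b ∨ (∃ c, Cyc a b c) ∨ ∃ c, Cyc b a c := by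
        unfold Cyc; decide +revert
      rcases hcases with rfl | ⟨c, hc⟩ | ⟨c, hc⟩
      · exact ⟨0, Q.zero_mem, fun s => by rw [hD, sub_self, LinearMap.zero_apply]⟩
      · exact ⟨(2 : A) • Phi c, Q.smul_mem _ (hPhiQ c), fun s => by
          rw [hD, hcyc a b c hc, LinearMap.smul_apply]⟩
      · exact ⟨-((2 : A) • Phi c), Q.neg_mem (Q.smul_mem _ (hPhiQ c)), fun s => by
          rw [hD, ← neg_sub, hcyc b a c hc, LinearMap.neg_apply, LinearMap.smul_apply]⟩
    unfold LofXi at hY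
    induction hY using Submodule.span_induction with
    | mem y hy =>
      obtain rfl | rfl | rfl := hy
      exacts [hxi 0, hxi 1, hxi 2]
    | zero => exact ⟨0, Q.zero_mem, fun s => by simp [R.zero_bracket]⟩
    | add y z _ _ ihy ihz =>
      obtain ⟨S₁, h₁, e₁⟩ := ihy
      obtain ⟨S₂, h₂, e₂⟩ := ihz
      refine ⟨S₁ + S₂, Q.add_mem h₁ h₂, fun s => ?_⟩
      rw [LinearMap.add_apply, ← e₁, ← e₂, R.add_bracket, R.add_bracket, map_add, map_add, map_add]
      abel
    | smul f y hy ih =>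
      obtain ⟨S₁, h₁, e₁⟩ := ih
      refine ⟨f • S₁, Q.smul_mem f h₁, fun s => ?_⟩
      rw [LinearMap.smul_apply, ← e₁, R.smul_bracket_leibniz, R.smul_bracket_leibniz, map_sub, map_sub,
        map_smul, map_smul, map_smul, map_smul, hprL y hy, smul_zero, smul_zero, sub_zero,
        sub_zero, map_smul, smul_sub]
  induction hS using Submodule.span_induction with
  | mem T hT =>
    have hneg : ∀ b, ∃ S' ∈ Q, ∀ s : EofXi R xi,
        pr ⁅Y, ((-Phi b) s : V)⁆ - (-Phi b) (pr ⁅Y, (s : V)⁆) = S' s := fun b => by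
      obtain ⟨S', h', e'⟩ := hgen b
      refine ⟨-S', Q.neg_mem h', fun s => ?_⟩
      rw [LinearMap.neg_apply, LinearMap.neg_apply, LinearMap.neg_apply, ← e',
        Submodule.coe_neg, R.bracket_neg, map_neg]
      abel
    obtain rfl | rfl | rfl := hT
    exacts [hneg 0, hneg 1, hneg 2]
  | zero => exact ⟨0, Q.zero_mem, fun s => by simp [R.bracket_zero]⟩
  | add T U _ _ ihT ihU =>
    obtain ⟨S₁, h₁, e₁⟩ := ihT
    obtain ⟨S₂, h₂, e₂⟩ := ihU
    refine ⟨S₁ + S₂, Q.add_mem h₁ h₂, fun s => ?_⟩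
    rw [LinearMap.add_apply, LinearMap.add_apply, LinearMap.add_apply, ← e₁, ← e₂,
      Submodule.coe_add, R.bracket_add, map_add]
    abel
  | smul f T hT ih =>
    obtain ⟨S₁, h₁, e₁⟩ := ih
    refine ⟨f • S₁ + R.act Y f • T, Q.add_mem (Q.smul_mem f h₁) (Q.smul_mem _ hT), fun s => ?_⟩
    rw [LinearMap.add_apply, LinearMap.smul_apply, LinearMap.smul_apply, LinearMap.smul_apply,
      LinearMap.smul_apply, ← e₁, Submodule.coe_smul, R.leibniz, map_add, map_smul, map_smul,
      hprE]
    module
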